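/- arXiv:1812.10512 — 2 statements merged into one kernel-verified Lean document; each statement's English description precedes it below -/
import Mathlib

section
/- Let λ > 0 and λ₁, μ, μ₁ ∈ ℝ with α = λ₁/λ ≠ -1. Assume either (c₁ < 0 and c₂ ≥ 0) or (c₁ = 0, c₂ > 0, δ > 1 and σ > 1) (i.e., (α,δ,σ) ∈ U(-,+)). Then: if |δ| ≤ 1, the discrete spectrum s_d(H) consists of exactly one real number ν₁, and ν₁ ∈ (4λ, ∞); if |δ| > 1, the discrete spectrum s_d(H) consists of exactly two distinct real numbers ν₁ and ν₂, where ν₁ ∈ (4λ, ∞) and ν₂ = κ. -/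
/-- The Hamiltonian `H = H₀ + H₁` acting on complex sequences `f : ℤ → ℂ`. -/
noncomputable def Hop (lam lam1 mu mu1 : ℝ) (f : ℤ → ℂ) : ℤ → ℂ := fun n =>
  if n = 0 then -((lam : ℂ) + (lam1 : ℂ)) * (f 1 - 2 * f 0 + f (-1)) + (mu : ℂ) * f 0
  else if n = 1 then -(lam : ℂ) * (f 2 - 2 * f 1 + f 0) - (lam1 : ℂ) * f 0 + (mu1 : ℂ) * f 1
  else if n = -1 then
    -(lam : ℂ) * (f 0 - 2 * f (-1) + f (-2)) - (lam1 : ℂ) * f 0 + (mu1 : ℂ) * f (-1)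
  else -(lam : ℂ) * (f (n + 1) - 2 * f n + f (n - 1))

/-- `ν` is an eigenvalue of `H`: there is a nonzero square-summable `f` with `Hf = νf`. -/
noncomputable def IsEigenvalue (lam lam1 mu mu1 ν : ℝ) : Prop :=
  ∃ f : ℤ → ℂ, f ≠ 0 ∧ Summable (fun n : ℤ => ‖f n‖ ^ 2) ∧
    ∀ n : ℤ, Hop lam lam1 mu mu1 f n = (ν : ℂ) * f n

/-- The discrete spectrum `s_d(H)`: real eigenvalues outside `[0, 4λ]`. -/
noncomputable def discSpec (lam lam1 mu mu1 : ℝ) : Set ℝ :=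
  {ν : ℝ | IsEigenvalue lam lam1 mu mu1 ν ∧ ν ∉ Set.Icc 0 (4 * lam)}

/-- The real number parametrized by `t`, where `t⁻¹` is the decay rate of an eigenfunction. -/
noncomputable def joukowskiEnergy (lam t : ℝ) : ℝ := lam * (2 - t - t⁻¹)

lemma two_lt_add_inv {t : ℝ} (ht : 1 < t) : 2 < t + t⁻¹ := by
  have h0 : 0 < t := by linarith
  have h : t + t⁻¹ - 2 = (t - 1) ^ 2 * t⁻¹ := by field_simp; ring
  have : 0 < (t - 1) ^ 2 * t⁻¹ := mul_pos (pow_pos (by linarith) 2) (inv_pos.2 h0)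
  linarith

lemma add_inv_lt_add_inv {s t : ℝ} (hs : 1 ≤ s) (hst : s < t) : s + s⁻¹ < t + t⁻¹ := by
  have hs0 : 0 < s := by linarith
  have ht0 : 0 < t := by linarith
  have h : t + t⁻¹ - (s + s⁻¹) = (t - s) * (s * t - 1) * (s⁻¹ * t⁻¹) := by
    field_simp; ring
  have : 0 < (t - s) * (s * t - 1) * (s⁻¹ * t⁻¹) :=
    mul_pos (mul_pos (by linarith) (by nlinarith)) (mul_pos (inv_pos.2 hs0) (inv_pos.2 ht0))
  linarith

lemma add_inv_lt_add_inv_of_neg {s t : ℝ} (ht : t ≤ -1) (hst : s < t) :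
    s + s⁻¹ < t + t⁻¹ := by
  have := add_inv_lt_add_inv (s := -t) (t := -s) (by linarith) (by linarith)
  rw [inv_neg, inv_neg] at this
  linarith

lemma four_mul_lt_joukowskiEnergy {lam t : ℝ} (hlam : 0 < lam) (ht : t < -1) :
    4 * lam < joukowskiEnergy lam t := by
  have := two_lt_add_inv (t := -t) (by linarith)
  rw [inv_neg] at this
  unfold joukowskiEnergy
  nlinarith

lemma joukowskiEnergy_notMem_Icc {lam t : ℝ} (hlam : 0 < lam) (ht : 1 < |t|) :
    joukowskiEnergy lam t ∉ Set.Icc 0 (4 * lam) := by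
  rintro ⟨h0, h4⟩
  rcases lt_abs.1 ht with h | h
  · have := two_lt_add_inv h
    unfold joukowskiEnergy at h0
    nlinarith
  · have := four_mul_lt_joukowskiEnergy hlam (t := t) (by linarith)
    linarith

lemma joukowskiEnergy_injOn {lam s t : ℝ} (hlam : 0 < lam) (hs : 1 < |s|) (ht : 1 < |t|)
    (h : joukowskiEnergy lam s = joukowskiEnergy lam t) : s = t := by
  have hs0 : s ≠ 0 := by rintro rfl; norm_num at hs
  have ht0 : t ≠ 0 := by rintro rfl; norm_num at ht
  have h1 := mul_left_cancel₀ hlam.ne' h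
  have h2 : (s - t) * (s * t - 1) = 0 := by
    field_simp at h1
    linear_combination -h1
  rcases mul_eq_zero.1 h2 with h3 | h3
  · linarith
  · have h4 : 1 < |s| * |t| := by nlinarith
    rw [← abs_mul, show s * t = 1 by linarith, abs_one] at h4
    exact absurd h4 (lt_irrefl _)

lemma exists_add_inv_eq {x : ℝ} (hx : 2 < x) : ∃ t : ℝ, 1 < t ∧ t + t⁻¹ = x := by
  have hsq := Real.sq_sqrt (show 0 ≤ x ^ 2 - 4 by nlinarith)
  have hnn := Real.sqrt_nonneg (x ^ 2 - 4)
  set r := Real.sqrt (x ^ 2 - 4)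
  have ht : 1 < (x + r) / 2 := by linarith
  refine ⟨(x + r) / 2, ht, ?_⟩
  have : ((x + r) / 2)⁻¹ = (x - r) / 2 := by
    apply inv_eq_of_mul_eq_one_right
    linear_combination (-1 / 4) * hsq
  rw [this]; ring

lemma exists_joukowskiEnergy_eq {lam ν : ℝ} (hlam : 0 < lam)
    (hν : ν ∉ Set.Icc 0 (4 * lam)) : ∃ t : ℝ, 1 < |t| ∧ joukowskiEnergy lam t = ν := by
  have hdiv : lam * (ν / lam) = ν := by field_simp
  by_cases h : 0 ≤ ν
  · have h4 : 4 * lam < ν := by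
      by_contra h'
      exact hν ⟨h, not_lt.1 h'⟩
    have : 4 < ν / lam := (lt_div_iff₀ hlam).2 h4
    obtain ⟨t, ht, hx⟩ := exists_add_inv_eq (x := ν / lam - 2) (by linarith)
    refine ⟨-t, by rw [abs_neg]; exact ht.trans_le (le_abs_self t), ?_⟩
    rw [joukowskiEnergy, inv_neg]
    linear_combination lam * hx + hdiv
  · have : ν / lam < 0 := div_neg_of_neg_of_pos (not_le.1 h) hlam
    obtain ⟨t, ht, hx⟩ := exists_add_inv_eq (x := 2 - ν / lam) (by linarith)
    refine ⟨t, ht.trans_le (le_abs_self t), ?_⟩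
    rw [joukowskiEnergy]
    linear_combination -lam * hx + hdiv

/-- A square-summable solution of a hyperbolic two-term recurrence is a decaying geometric
sequence. -/
lemma eq_geometric_of_recurrence {t : ℝ} (ht : 1 < |t|) (g : ℕ → ℂ)
    (hsum : Summable fun n => ‖g n‖ ^ 2)
    (hrec : ∀ n, g (n + 2) = ((t : ℂ) + (t : ℂ)⁻¹) * g (n + 1) - g n) (n : ℕ) :
    g n = g 0 * ((t : ℂ)⁻¹) ^ n := by
  have ht0 : (t : ℂ) ≠ 0 := by
    intro h
    rw [Complex.ofReal_eq_zero] at h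
    subst h
    norm_num at ht
  have hgrow : ∀ n, g (n + 1) - (t : ℂ)⁻¹ * g n = (t : ℂ) ^ n * (g 1 - (t : ℂ)⁻¹ * g 0) := by
    intro n
    induction n with
    | zero => simp
    | succ k ih =>
      rw [pow_succ', mul_assoc, ← ih, hrec k]
      field_simp
      ring
  have hg0 : Filter.Tendsto g Filter.atTop (nhds 0) := by
    rw [tendsto_zero_iff_norm_tendsto_zero]
    have := (hsum.tendsto_atTop_zero).sqrt
    simpa [Real.sqrt_sq] using this
  have hdiff : Filter.Tendsto (fun n => ‖g (n + 1) - (t : ℂ)⁻¹ * g n‖) Filter.atTop (nhds 0) := by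
    have := ((Filter.tendsto_add_atTop_iff_nat 1).2 hg0).sub (hg0.const_mul (t : ℂ)⁻¹)
    simpa using this.norm
  have hle : ‖g 1 - (t : ℂ)⁻¹ * g 0‖ ≤ 0 := by
    refine ge_of_tendsto' hdiff fun n => ?_
    rw [hgrow n, norm_mul, norm_pow, Complex.norm_real, Real.norm_eq_abs]
    exact le_mul_of_one_le_left (norm_nonneg _) (one_le_pow₀ ht.le)
  have hzero := norm_le_zero_iff.1 hle
  induction n with
  | zero => simp
  | succ k ih =>
    have := hgrow k
    rw [hzero, mul_zero, sub_eq_zero] at this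
    rw [this, ih, pow_succ]
    ring

lemma characteristic_of_isEigenvalue {lam lam1 mu mu1 t : ℝ} (hlam : 0 < lam)
    (ha : lam + lam1 ≠ 0) (ht : 1 < |t|)
    (h : IsEigenvalue lam lam1 mu mu1 (joukowskiEnergy lam t)) :
    mu1 + lam * t = 0 ∨
      (2 * lam1 + mu + lam * (t + t⁻¹)) * (mu1 + lam * t) = 2 * (lam + lam1) ^ 2 := by
  obtain ⟨f, hf, hsum, hH⟩ := h
  have hlamC : (lam : ℂ) ≠ 0 := Complex.ofReal_ne_zero.2 hlam.ne'
  have haC : (lam : ℂ) + (lam1 : ℂ) ≠ 0 := by exact_mod_cast ha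
  have ht0 : (t : ℂ) ≠ 0 := by
    intro h
    rw [Complex.ofReal_eq_zero] at h
    subst h
    norm_num at ht
  have hE : ((joukowskiEnergy lam t : ℝ) : ℂ) = (lam : ℂ) * (2 - (t : ℂ) - (t : ℂ)⁻¹) := by
    simp [joukowskiEnergy]
  rw [hE] at hH
  have hpos := eq_geometric_of_recurrence ht (fun n : ℕ => f ((n : ℤ) + 1))
    (hsum.comp_injective (i := fun n : ℕ => (n : ℤ) + 1) fun a b hab => by simpa using hab)
    (fun n => by
      have h := hH ((n : ℤ) + 2)
      rw [Hop, if_neg (by omega), if_neg (by omega), if_neg (by omega)] at h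
      apply mul_left_cancel₀ hlamC
      push_cast
      rw [show (n : ℤ) + 2 + 1 = n + 3 by ring, show (n : ℤ) + 2 - 1 = n + 1 by ring] at h
      rw [show (n : ℤ) + 2 + 1 = n + 3 by ring, show (n : ℤ) + 1 + 1 = n + 2 by ring]
      linear_combination -h)
  have hneg := eq_geometric_of_recurrence ht (fun n : ℕ => f (-(n : ℤ) - 1))
    (hsum.comp_injective (i := fun n : ℕ => -(n : ℤ) - 1) fun a b hab => by simpa using hab)
    (fun n => by
      have h := hH (-(n : ℤ) - 2)
      rw [Hop, if_neg (by omega), if_neg (by omega), if_neg (by omega)] at h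
      apply mul_left_cancel₀ hlamC
      push_cast
      rw [show -(n : ℤ) - 2 + 1 = -n - 1 by ring, show -(n : ℤ) - 2 - 1 = -n - 3 by ring] at h
      rw [show -((n : ℤ) + 2) - 1 = -n - 3 by ring, show -((n : ℤ) + 1) - 1 = -n - 2 by ring]
      linear_combination -h)
  have hf2 := hpos 1
  have hfm2 := hneg 1
  norm_num at hpos hneg hf2 hfm2
  have h0 := hH 0
  have h1 := hH 1
  have hm1 := hH (-1)
  norm_num [Hop] at h0 h1 hm1
  rw [hf2] at h1
  rw [hfm2] at hm1
  have e1 : ((lam : ℂ) + lam1) * f 0 = (mu1 + lam * t) * f 1 := by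
    linear_combination -h1
  have em1 : ((lam : ℂ) + lam1) * f 0 = (mu1 + lam * t) * f (-1) := by
    linear_combination -hm1
  have e0 : ((lam : ℂ) + lam1) * (f 1 + f (-1)) =
      (2 * lam1 + mu + lam * (t + (t : ℂ)⁻¹)) * f 0 := by
    linear_combination -h0
  by_cases hu : mu1 + lam * t = 0
  · exact Or.inl hu
  right
  have huC : (mu1 : ℂ) + lam * t ≠ 0 := by exact_mod_cast hu
  have hf0 : f 0 ≠ 0 := by
    intro hz
    rw [hz, mul_zero] at e1 em1
    have z1 : f 1 = 0 := (mul_eq_zero.1 e1.symm).resolve_left huC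
    have zm1 : f (-1) = 0 := (mul_eq_zero.1 em1.symm).resolve_left huC
    apply hf
    funext n
    rcases lt_trichotomy n 0 with hn | rfl | hn
    · obtain ⟨k, rfl⟩ : ∃ k : ℕ, n = -(k : ℤ) - 1 := ⟨(-n - 1).toNat, by omega⟩
      simp [hneg, zm1]
    · exact hz
    · obtain ⟨k, rfl⟩ : ∃ k : ℕ, n = (k : ℤ) + 1 := ⟨(n - 1).toNat, by omega⟩
      simp [hpos, z1]
  have hC : (2 * (lam1 : ℂ) + mu + lam * (t + (t : ℂ)⁻¹)) * (mu1 + lam * t) =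
      2 * ((lam : ℂ) + lam1) ^ 2 := by
    apply mul_right_cancel₀ hf0
    linear_combination -(mu1 + lam * t : ℂ) * e0 - (lam + lam1 : ℂ) * e1 - (lam + lam1 : ℂ) * em1
  exact_mod_cast hC

/-- The sequence with value `c` at `0` and geometric tails `A sⁿ`, `B sⁿ` at `n`, `-n`. -/
noncomputable def twoSidedGeometric (c A B s : ℂ) (n : ℤ) : ℂ :=
  if n = 0 then c else (if 0 < n then A else B) * s ^ n.natAbs

lemma summable_twoSidedGeometric {c A B s : ℂ} (hs : ‖s‖ < 1) :
    Summable fun n : ℤ => ‖twoSidedGeometric c A B s n‖ ^ 2 := by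
  have hgeo (C : ℂ) : Summable fun n : ℕ => ‖C * s ^ (n + 1)‖ ^ 2 := by
    have h := (summable_geometric_of_lt_one (sq_nonneg ‖s‖)
      (by nlinarith [norm_nonneg s] : ‖s‖ ^ 2 < 1)).mul_left (‖C‖ ^ 2 * ‖s‖ ^ 2)
    refine h.congr fun n => ?_
    rw [norm_mul, norm_pow]
    ring
  refine Summable.of_nat_of_neg ((summable_nat_add_iff 1).1 ((hgeo A).congr fun n => ?_))
    ((summable_nat_add_iff 1).1 ((hgeo B).congr fun n => ?_))
  · rw [twoSidedGeometric, if_neg (by omega), if_pos (by omega)]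
    rfl
  · rw [twoSidedGeometric, if_neg (by omega), if_neg (by omega),
      show (-((n + 1 : ℕ) : ℤ)).natAbs = n + 1 by omega]

lemma isEigenvalue_of_twoSidedGeometric {lam lam1 mu mu1 t : ℝ} {c A B : ℂ} (ht : 1 < |t|)
    (hA : A ≠ 0) (e1 : ((lam : ℂ) + lam1) * c = (mu1 + lam * t) * (A * (t : ℂ)⁻¹))
    (em1 : ((lam : ℂ) + lam1) * c = (mu1 + lam * t) * (B * (t : ℂ)⁻¹))
    (e0 : ((lam : ℂ) + lam1) * (A * (t : ℂ)⁻¹ + B * (t : ℂ)⁻¹) =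
      (2 * lam1 + mu + lam * (t + (t : ℂ)⁻¹)) * c) :
    IsEigenvalue lam lam1 mu mu1 (joukowskiEnergy lam t) := by
  have ht0 : (t : ℂ) ≠ 0 := by
    intro h
    rw [Complex.ofReal_eq_zero] at h
    subst h
    norm_num at ht
  have hE : ((joukowskiEnergy lam t : ℝ) : ℂ) = (lam : ℂ) * (2 - (t : ℂ) - (t : ℂ)⁻¹) := by
    simp [joukowskiEnergy]
  have hts : (t : ℂ) * (t : ℂ)⁻¹ = 1 := mul_inv_cancel₀ ht0
  refine ⟨twoSidedGeometric c A B (t : ℂ)⁻¹, ?_, summable_twoSidedGeometric ?_, fun n => ?_⟩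
  · intro h
    have := congrFun h 1
    simp [twoSidedGeometric, hA, ht0] at this
  · rw [norm_inv, Complex.norm_real, Real.norm_eq_abs]
    exact inv_lt_one_of_one_lt₀ ht
  rw [hE]
  generalize (t : ℂ)⁻¹ = s at *
  have hpos (k : ℕ) : twoSidedGeometric c A B s ((k : ℤ) + 1) = A * s ^ (k + 1) := by
    rw [twoSidedGeometric, if_neg (by omega), if_pos (by omega),
      show ((k : ℤ) + 1).natAbs = k + 1 by omega]
  have hneg (k : ℕ) : twoSidedGeometric c A B s (-(k : ℤ) - 1) = B * s ^ (k + 1) := by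
    rw [twoSidedGeometric, if_neg (by omega), if_neg (by omega),
      show (-(k : ℤ) - 1).natAbs = k + 1 by omega]
  have v0 : twoSidedGeometric c A B s 0 = c := by simp [twoSidedGeometric]
  have v1 := hpos 0
  have v2 := hpos 1
  have vm1 := hneg 0
  have vm2 := hneg 1
  norm_num at v1 v2 vm1 vm2
  by_cases hn0 : n = 0
  · subst hn0
    simp only [Hop, if_true, v0, v1, vm1]
    linear_combination -e0
  by_cases hn1 : n = 1
  · subst hn1
    norm_num [Hop, v0, v1, v2]
    linear_combination -e1
  by_cases hnm1 : n = -1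
  · subst hnm1
    norm_num [Hop, v0, vm1, vm2]
    linear_combination -em1
  rw [Hop, if_neg hn0, if_neg hn1, if_neg hnm1]
  rcases lt_or_gt_of_ne hn0 with hn | hn
  · obtain ⟨k, rfl⟩ : ∃ k : ℕ, n = -((k + 1 : ℕ) : ℤ) - 1 := ⟨(-n - 2).toNat, by omega⟩
    rw [show -((k + 1 : ℕ) : ℤ) - 1 + 1 = -(k : ℤ) - 1 by push_cast; ring,
      show -((k + 1 : ℕ) : ℤ) - 1 - 1 = -((k + 2 : ℕ) : ℤ) - 1 by push_cast; ring,
      hneg, hneg, hneg]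
    linear_combination lam * B * s ^ (k + 1) * hts
  · obtain ⟨k, rfl⟩ : ∃ k : ℕ, n = ((k + 1 : ℕ) : ℤ) + 1 := ⟨(n - 2).toNat, by omega⟩
    rw [show ((k + 1 : ℕ) : ℤ) + 1 - 1 = (k : ℤ) + 1 by push_cast; ring,
      show ((k + 1 : ℕ) : ℤ) + 1 + 1 = ((k + 2 : ℕ) : ℤ) + 1 by push_cast; ring,
      hpos, hpos, hpos]
    linear_combination lam * A * s ^ (k + 1) * hts

lemma isEigenvalue_of_characteristic {lam lam1 mu mu1 t : ℝ}
    (ha : lam + lam1 ≠ 0) (ht : 1 < |t|)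
    (h : mu1 + lam * t = 0 ∨
      (2 * lam1 + mu + lam * (t + t⁻¹)) * (mu1 + lam * t) = 2 * (lam + lam1) ^ 2) :
    IsEigenvalue lam lam1 mu mu1 (joukowskiEnergy lam t) := by
  have haC : (lam : ℂ) + (lam1 : ℂ) ≠ 0 := by exact_mod_cast ha
  have ht0 : (t : ℂ) ≠ 0 := by
    intro h
    rw [Complex.ofReal_eq_zero] at h
    subst h
    norm_num at ht
  have hts : (t : ℂ) * (t : ℂ)⁻¹ = 1 := mul_inv_cancel₀ ht0
  rcases h with h | h
  · have hC : (mu1 : ℂ) + lam * t = 0 := by exact_mod_cast h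
    exact isEigenvalue_of_twoSidedGeometric (c := 0) (A := 1) (B := -1) ht one_ne_zero
      (by rw [hC]; ring) (by rw [hC]; ring) (by ring)
  · have hC : (2 * (lam1 : ℂ) + mu + lam * (t + (t : ℂ)⁻¹)) * (mu1 + lam * t) =
        2 * ((lam : ℂ) + lam1) ^ 2 := by exact_mod_cast h
    refine isEigenvalue_of_twoSidedGeometric (c := mu1 + lam * t) (A := (lam + lam1) * t)
      (B := (lam + lam1) * t) ht (mul_ne_zero haC ht0) ?_ ?_ ?_
    · linear_combination -(lam + lam1 : ℂ) * (mu1 + lam * t) * hts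
    · linear_combination -(lam + lam1 : ℂ) * (mu1 + lam * t) * hts
    · linear_combination 2 * (lam + lam1 : ℂ) ^ 2 * hts - hC

lemma exists_even_root {b de si x : ℝ} (hb : 0 < b) (hx : x ≤ -1) (hxd : -(1 + |de|) ≤ x)
    (hP : 0 < (x ^ 2 + 2 * si * x + 1) * (x + de) - b * x) :
    ∃ t < x, (2 * si + (t + t⁻¹)) * (t + de) = b := by
  have hcont : Continuous fun t : ℝ => (t ^ 2 + 2 * si * t + 1) * (t + de) - b * t := by fun_prop
  set M := 2 + |de| + 2 * |si| + b with hM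
  have hd := le_abs_self de
  have hs := le_abs_self si
  have hd0 := abs_nonneg de
  have hs0 := abs_nonneg si
  have hMx : -M < x := by linarith
  have hneg : ((-M) ^ 2 + 2 * si * (-M) + 1) * (-M + de) - b * (-M) < 0 := by
    have h1 : M * (2 + b) ≤ (-M) ^ 2 + 2 * si * (-M) + 1 := by nlinarith
    have h2 : 2 + b ≤ M - de := by linarith
    have h3 : M * (2 + b) * (2 + b) ≤ ((-M) ^ 2 + 2 * si * (-M) + 1) * (M - de) :=
      mul_le_mul h1 h2 (by linarith) (le_trans (by positivity) h1)
    have hM0 : 0 < M := by linarith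
    have h4 : M * b < M * ((2 + b) * (2 + b)) := mul_lt_mul_of_pos_left (by nlinarith) hM0
    nlinarith
  obtain ⟨t, ⟨_, htx⟩, ht⟩ := intermediate_value_Ioo hMx.le hcont.continuousOn ⟨hneg, hP⟩
  refine ⟨t, htx, ?_⟩
  have ht0 : t ≠ 0 := by rintro rfl; linarith
  simp only at ht
  field_simp
  linear_combination ht

lemma even_root_unique {b de si s t : ℝ} (hb : 0 < b) (hc1 : 2 * ((de - 1) * (si - 1)) ≤ b)
    (hs : s < -1) (ht : t < -1) (es : (2 * si + (s + s⁻¹)) * (s + de) = b)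
    (et : (2 * si + (t + t⁻¹)) * (t + de) = b) : s = t := by
  have hsign {r : ℝ} (hr : r < -1) (er : (2 * si + (r + r⁻¹)) * (r + de) = b) :
      2 * si + (r + r⁻¹) < 0 ∧ r + de < 0 := by
    have hmono := add_inv_lt_add_inv_of_neg le_rfl hr
    norm_num at hmono
    rcases mul_pos_iff.1 (er.symm ▸ hb) with ⟨h1, h2⟩ | h
    · exfalso
      have := mul_lt_mul'' (show 2 * si + (r + r⁻¹) < 2 * si - 2 by linarith)
        (show r + de < de - 1 by linarith) h1.le h2.le
      nlinarith
    · exact h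
  have key {r r' : ℝ} (hr' : r' < -1) (hrr : r < r')
      (er : (2 * si + (r + r⁻¹)) * (r + de) = b)
      (er' : (2 * si + (r' + r'⁻¹)) * (r' + de) = b) : False := by
    obtain ⟨h1, h2⟩ := hsign hr' er'
    have hmono := add_inv_lt_add_inv_of_neg hr'.le hrr
    have := mul_lt_mul'' (show -(2 * si + (r' + r'⁻¹)) < -(2 * si + (r + r⁻¹)) by linarith)
      (show -(r' + de) < -(r + de) by linarith) (by linarith) (by linarith)
    linarith [neg_mul_neg (2 * si + (r' + r'⁻¹)) (r' + de),
      neg_mul_neg (2 * si + (r + r⁻¹)) (r + de)]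
  rcases lt_trichotomy s t with h | h | h
  · exact (key ht h es et).elim
  · exact h
  · exact (key hs h et es).elim

lemma no_even_root_of_one_lt {b de si t : ℝ} (hb : 0 < b)
    (hc2 : b ≤ 2 * ((de + 1) * (si + 1))) (hds : 0 < de + 1 ∨ 0 < si + 1) (ht : 1 < t) :
    (2 * si + (t + t⁻¹)) * (t + de) ≠ b := by
  have hmul : 0 < (de + 1) * (si + 1) := by linarith
  obtain ⟨h1, h2⟩ : 0 < de + 1 ∧ 0 < si + 1 := by
    rcases mul_pos_iff.1 hmul with h | ⟨h, h'⟩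
    · exact h
    · rcases hds with h3 | h3 <;> linarith
  have := two_lt_add_inv ht
  have := mul_lt_mul'' (show 2 * si + 2 < 2 * si + (t + t⁻¹) by linarith)
    (show 1 + de < t + de by linarith) (by linarith) (by linarith)
  intro h
  nlinarith

lemma existsUnique_even_root {al de si : ℝ} (hal : al ≠ -1)
    (hreg : ((de - 1) * (si - 1) - (al + 1) ^ 2 < 0 ∧ 0 ≤ (de + 1) * (si + 1) - (al + 1) ^ 2) ∨
      ((de - 1) * (si - 1) - (al + 1) ^ 2 = 0 ∧ 0 < (de + 1) * (si + 1) - (al + 1) ^ 2 ∧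
        1 < de ∧ 1 < si)) :
    ∃ t1 < -1, ∀ t, 1 < |t| →
      ((2 * si + (t + t⁻¹)) * (t + de) = 2 * (al + 1) ^ 2 ↔ t = t1) := by
  have hb : 0 < 2 * (al + 1) ^ 2 := by
    have : al + 1 ≠ 0 := fun h => hal (by linarith)
    positivity
  obtain ⟨t1, ht1, hroot⟩ :
      ∃ t < -1, (2 * si + (t + t⁻¹)) * (t + de) = 2 * (al + 1) ^ 2 := by
    rcases hreg with ⟨h1, _⟩ | ⟨_, _, hd, _⟩
    · exact exists_even_root hb le_rfl (by linarith [abs_nonneg de]) (by nlinarith)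
    · obtain ⟨t, ht, h⟩ := exists_even_root (x := -de) (si := si) hb (by linarith)
        (by linarith [le_abs_self de]) (by nlinarith)
      exact ⟨t, by linarith, h⟩
  refine ⟨t1, ht1, fun t ht => ⟨fun h => ?_, fun h => h ▸ hroot⟩⟩
  rcases lt_abs.1 ht with h1 | h1
  · refine absurd h (no_even_root_of_one_lt hb ?_ ?_ h1)
    · rcases hreg with h | h <;> linarith [h.2]
    · rcases hreg with h | h
      · by_contra! hcon
        nlinarith [h.1, h.2, hcon.1, hcon.2]
      · exact Or.inl (by linarith [h.2.2.1])
  · refine even_root_unique hb ?_ (by linarith) ht1 h hroot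
    rcases hreg with h | h <;> linarith [h.1]

lemma discSpec_eq_image {lam lam1 mu mu1 al de si : ℝ} (hlam : 0 < lam)
    (hal : al = lam1 / lam) (hde : de = mu1 / lam) (hsi : si = (2 * lam1 + mu) / (2 * lam))
    (halne : al ≠ -1) :
    discSpec lam lam1 mu mu1 = joukowskiEnergy lam '' {t | 1 < |t| ∧
      (t = -de ∨ (2 * si + (t + t⁻¹)) * (t + de) = 2 * (al + 1) ^ 2)} := by
  have h1 : lam1 = lam * al := by rw [hal]; field_simp
  have h2 : mu1 = lam * de := by rw [hde]; field_simp
  have h3 : mu = lam * (2 * si) - 2 * lam1 := by rw [hsi]; field_simp; ring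
  have ha : lam + lam1 ≠ 0 := by
    intro h
    apply halne
    apply mul_left_cancel₀ hlam.ne'
    linarith
  have hchar (t : ℝ) : (t = -de ∨ (2 * si + (t + t⁻¹)) * (t + de) = 2 * (al + 1) ^ 2) ↔
      (mu1 + lam * t = 0 ∨
        (2 * lam1 + mu + lam * (t + t⁻¹)) * (mu1 + lam * t) = 2 * (lam + lam1) ^ 2) := by
    apply or_congr
    · rw [h2, ← mul_add, mul_eq_zero, or_iff_right hlam.ne', add_comm, eq_neg_iff_add_eq_zero]
    · rw [h3, h2, h1, ← mul_right_inj' (pow_ne_zero 2 hlam.ne')]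
      constructor <;> intro h <;> linear_combination h
  ext ν
  constructor
  · rintro ⟨hν, hmem⟩
    obtain ⟨t, ht, rfl⟩ := exists_joukowskiEnergy_eq hlam hmem
    exact ⟨t, ⟨ht, (hchar t).2 (characteristic_of_isEigenvalue hlam ha ht hν)⟩, rfl⟩
  · rintro ⟨t, ⟨ht, h⟩, rfl⟩
    exact ⟨isEigenvalue_of_characteristic ha ht ((hchar t).1 h),
      joukowskiEnergy_notMem_Icc hlam ht⟩

/-- Theorem 1 d): in the region `U(-,+)`, if `|δ| ≤ 1` the discrete spectrum is a single
eigenvalue `ν₁ ∈ (4λ, ∞)`; if `|δ| > 1` it consists of exactly two distinct eigenvalues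
`ν₁ ∈ (4λ, ∞)` and `ν₂ = κ`. -/
theorem stmt3 (lam lam1 mu mu1 al de si c1 c2 kap : ℝ)
    (hlam : 0 < lam)
    (hal : al = lam1 / lam) (hde : de = mu1 / lam) (hsi : si = (2 * lam1 + mu) / (2 * lam))
    (hc1 : c1 = (de - 1) * (si - 1) - (al + 1) ^ 2)
    (hc2 : c2 = (de + 1) * (si + 1) - (al + 1) ^ 2)
    (hkap : kap = (mu1 + lam) ^ 2 / mu1)
    (halne : al ≠ -1)
    (hreg : (c1 < 0 ∧ 0 ≤ c2) ∨ (c1 = 0 ∧ 0 < c2 ∧ 1 < de ∧ 1 < si)) :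
    (|de| ≤ 1 →
      ∃ ν1 : ℝ, 4 * lam < ν1 ∧ discSpec lam lam1 mu mu1 = {ν1}) ∧
    (1 < |de| →
      ∃ ν1 ν2 : ℝ, 4 * lam < ν1 ∧ ν2 = kap ∧ ν1 ≠ ν2 ∧
        discSpec lam lam1 mu mu1 = {ν1, ν2}) := by
  subst hc1 hc2
  obtain ⟨t1, ht1, huniq⟩ := existsUnique_even_root halne hreg
  have ht1abs : 1 < |t1| := lt_abs.2 (Or.inr (by linarith))
  have hspec := discSpec_eq_image (mu := mu) (si := si) hlam hal hde hsi halne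
  have hν1 := four_mul_lt_joukowskiEnergy hlam ht1
  refine ⟨fun hd => ⟨joukowskiEnergy lam t1, hν1, ?_⟩,
    fun hd => ⟨joukowskiEnergy lam t1, joukowskiEnergy lam (-de), hν1, ?_, ?_, ?_⟩⟩
  · have hset : {t : ℝ | 1 < |t| ∧ (t = -de ∨
        (2 * si + (t + t⁻¹)) * (t + de) = 2 * (al + 1) ^ 2)} = {t1} := by
      ext t
      constructor
      · rintro ⟨ht, rfl | h⟩
        · rw [abs_neg] at ht
          exact absurd ht (not_lt.2 hd)
        · exact (huniq t ht).1 h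
      · rintro rfl
        exact ⟨ht1abs, Or.inr ((huniq t ht1abs).2 rfl)⟩
    rw [hspec, hset, Set.image_singleton]
  · have hde0 : de ≠ 0 := by rintro rfl; norm_num at hd
    have hmu : mu1 = lam * de := by rw [hde]; field_simp
    rw [hkap, hmu, joukowskiEnergy, inv_neg]
    field_simp
    ring
  · intro h
    have hEq := joukowskiEnergy_injOn hlam ht1abs (by rwa [abs_neg]) h
    have hroot := (huniq t1 ht1abs).2 rfl
    rw [hEq, neg_add_cancel, mul_zero] at hroot
    have : al + 1 = 0 := by
      apply pow_eq_zero_iff (two_ne_zero) |>.1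
      linarith
    exact halne (by linarith)
  · have hset : {t : ℝ | 1 < |t| ∧ (t = -de ∨
        (2 * si + (t + t⁻¹)) * (t + de) = 2 * (al + 1) ^ 2)} = {t1, -de} := by
      ext t
      constructor
      · rintro ⟨ht, rfl | h⟩
        · exact Or.inr rfl
        · exact Or.inl ((huniq t ht).1 h)
      · rintro (rfl | rfl)
        · exact ⟨ht1abs, Or.inr ((huniq t ht1abs).2 rfl)⟩
        · exact ⟨by rwa [abs_neg], Or.inl rfl⟩
    rw [hspec, hset, Set.image_pair]
end

section
/- Let λ > 0 and λ₁, μ, μ₁ ∈ ℝ with λ₁ = -λ (i.e., α = -1). If |δ| ≤ 1 and |σ| > 1, then the discrete spectrum satisfies s_d(H) = {μ}. -/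
/-- A square-summable solution of `g (n + 2) = x g (n + 1) - g n` with `2 ≤ |x|` and boundary
condition `g 1 = (x + d) g 0`, `|d| ≤ 1`, vanishes: its modulus is nondecreasing. -/
theorem eq_zero_of_summable_of_recurrence {g : ℕ → ℂ} {x d : ℝ} (hx : 2 ≤ |x|) (hd : |d| ≤ 1)
    (h0 : g 1 = ((x : ℂ) + d) * g 0) (hg : ∀ n, g (n + 2) = x * g (n + 1) - g n)
    (hs : Summable fun n => ‖g n‖ ^ 2) (n : ℕ) : g n = 0 := by
  have hstep : ∀ n, ‖g n‖ ≤ ‖g (n + 1)‖ := by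
    intro n
    induction n with
    | zero =>
      have hxd : 1 ≤ ‖(x : ℂ) + d‖ := by
        rw [← Complex.ofReal_add, Complex.norm_real, Real.norm_eq_abs]
        have := abs_sub_abs_le_abs_sub x (-d)
        rw [abs_neg, sub_neg_eq_add] at this
        linarith
      rw [zero_add, h0, norm_mul]
      exact le_mul_of_one_le_left (norm_nonneg _) hxd
    | succ n ih =>
      have h := norm_sub_norm_le ((x : ℂ) * g (n + 1)) (g n)
      rw [norm_mul, Complex.norm_real, Real.norm_eq_abs, ← hg] at h
      nlinarith [norm_nonneg (g (n + 1))]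
  have hmono : Monotone fun n => ‖g n‖ ^ 2 := monotone_nat_of_le_succ fun n =>
    pow_le_pow_left₀ (norm_nonneg _) (hstep n) 2
  have hle := hmono.ge_of_tendsto hs.tendsto_atTop_zero n
  simpa using le_antisymm hle (by positivity)

/-- When `λ₁ = -λ`, the unit sequence at the origin is an eigenvector of `H` for `μ`. -/
theorem isEigenvalue_neg (lam mu mu1 : ℝ) : IsEigenvalue lam (-lam) mu mu1 mu := by
  refine ⟨Pi.single 0 1, by simp, ?_, fun n => ?_⟩
  · refine summable_of_ne_finset_zero (s := {0}) fun n hn => ?_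
    simp [Pi.single_eq_of_ne (Finset.notMem_singleton.mp hn)]
  · unfold Hop
    split_ifs with h0 h1 h2
    · simp [h0]
    · simp [h1]
    · simp [h2]
    · have h3 : n + 1 ≠ 0 := by omega
      have h4 : n - 1 ≠ 0 := by omega
      simp [h0, h3, h4]

/-- When `λ₁ = -λ`, the only eigenvalue outside `[0, 4λ]` can be `μ`, provided `|μ₁ / λ| ≤ 1`. -/
theorem eq_of_isEigenvalue_neg {lam mu mu1 ν : ℝ} (hlam : 0 < lam) (hd : |mu1 / lam| ≤ 1)
    (hν : ν ∉ Set.Icc 0 (4 * lam)) (h : IsEigenvalue lam (-lam) mu mu1 ν) : ν = mu := by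
  obtain ⟨f, hf, hs, hH⟩ := h
  by_contra hne
  have hlamC : (lam : ℂ) ≠ 0 := by exact_mod_cast hlam.ne'
  have hf0 : f 0 = 0 := by
    have h0 := hH 0
    simp only [Hop, if_true, Complex.ofReal_neg, add_neg_cancel, neg_zero, zero_mul,
      zero_add] at h0
    by_contra hf0
    exact hne (by exact_mod_cast (mul_right_cancel₀ hf0 h0).symm)
  have hx : 2 ≤ |2 - ν / lam| := by
    rw [le_abs]
    by_cases hn : ν < 0
    · left
      linarith [div_neg_of_neg_of_pos hn hlam]
    · right
      have : 4 * lam < ν := by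
        by_contra h4
        exact hν ⟨not_lt.mp hn, not_lt.mp h4⟩
      linarith [(lt_div_iff₀ hlam).mpr this]
  have hrec : ∀ n : ℤ, n ≠ 0 → n ≠ 1 → n ≠ -1 →
      f (n + 1) + f (n - 1) = ((2 - ν / lam : ℝ) : ℂ) * f n := by
    intro n h0 h1 h2
    have hn := hH n
    simp only [Hop, h0, h1, h2, if_false] at hn
    push_cast
    field_simp
    linear_combination -hn
  have hright : ∀ n : ℕ, f (n + 1) = 0 := by
    refine eq_zero_of_summable_of_recurrence (g := fun n : ℕ => f (n + 1)) hx hd ?_ (fun n => ?_)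
      (hs.comp_injective (i := fun n : ℕ => (n : ℤ) + 1) fun a b hab => by simpa using hab)
    · have h1 := hH 1
      norm_num [Hop] at h1
      norm_num
      field_simp
      linear_combination -h1
    · have hn := hrec (n + 2) (by omega) (by omega) (by omega)
      rw [show (n : ℤ) + 2 - 1 = n + 1 by ring] at hn
      push_cast at hn ⊢
      rw [show (n : ℤ) + 1 + 1 = n + 2 by ring]
      linear_combination hn
  have hleft : ∀ n : ℕ, f (-(n + 1)) = 0 := by
    refine eq_zero_of_summable_of_recurrence (g := fun n : ℕ => f (-(n + 1))) hx hd ?_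
      (fun n => ?_)
      (hs.comp_injective (i := fun n : ℕ => -((n : ℤ) + 1)) fun a b hab => by simpa using hab)
    · have h1 := hH (-1)
      norm_num [Hop] at h1
      norm_num
      field_simp
      linear_combination -h1
    · have hn := hrec (-(n + 2)) (by omega) (by omega) (by omega)
      rw [show -((n : ℤ) + 2) + 1 = -(n + 1) by ring,
        show -((n : ℤ) + 2) - 1 = -(n + 2 + 1) by ring] at hn
      push_cast at hn ⊢
      rw [show (n : ℤ) + 1 + 1 = n + 2 by ring]
      linear_combination hn
  refine hf (funext fun n => ?_)
  rcases lt_trichotomy n 0 with hn | rfl | hn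
  · have h := hleft (-n - 1).toNat
    rwa [show -(((-n - 1).toNat : ℤ) + 1) = n by omega] at h
  · exact hf0
  · have h := hright (n - 1).toNat
    rwa [show ((n - 1).toNat : ℤ) + 1 = n by omega] at h

/-- Theorem 2, second item: for `λ₁ = -λ`, if `|δ| ≤ 1` and `|σ| > 1`, then `s_d(H) = {μ}`. -/
theorem stmt8 (lam lam1 mu mu1 de si : ℝ)
    (hlam : 0 < lam)
    (hlam1 : lam1 = -lam)
    (hde : de = mu1 / lam) (hsi : si = (2 * lam1 + mu) / (2 * lam))
    (h1 : |de| ≤ 1) (h2 : 1 < |si|) :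
    discSpec lam lam1 mu mu1 = {mu} := by
  subst hlam1 hde hsi
  have hmu : mu ∉ Set.Icc 0 (4 * lam) := by
    rintro ⟨hl, hu⟩
    refine h2.not_ge (abs_le.mpr ⟨?_, ?_⟩)
    · rw [le_div_iff₀ (by positivity)]
      linarith
    · rw [div_le_iff₀ (by positivity)]
      linarith
  ext ν
  constructor
  · rintro ⟨hν, hout⟩
    exact eq_of_isEigenvalue_neg hlam h1 hout hν
  · rintro rfl
    exact ⟨isEigenvalue_neg lam ν mu1, hmu⟩
end
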